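/- (Proposition 3 for the XXZ model) Fix Δ ≥ 0 and let H_Δ be the spin-1/2 XXZ Hamiltonian on G. Let E₁^Δ be the smallest eigenvalue of H_Δ restricted to the one-magnon sector ℋ_1, and E_a^Δ the smallest eigenvalue of H_Δ restricted to ℋ_a. Then E_a^Δ ≥ Δ·(1−a)·N·j/8 + a·E₁^Δ for all 1 ≤ a ≤ N. -/

import Mathlib

open Matrix BigOperators
open scoped ComplexOrder

/-- Spin-1/2 configurations: `true` means spin down. -/
abbrev Conf (V : Type*) := V → Bool

variable {V : Type*}

/-- The operator `P_{uv}` interchanging the spin values at sites `u` and `v`. -/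
noncomputable def swapOp [Fintype V] [DecidableEq V] (u v : V) :
    Matrix (Conf V) (Conf V) ℂ :=
  Matrix.of fun σ τ => if τ = σ ∘ (Equiv.swap u v) then 1 else 0

lemma swapOp_comm [Fintype V] [DecidableEq V] (u v : V) :
    swapOp (V := V) u v = swapOp v u := by
  unfold swapOp
  rw [Equiv.swap_comm]

/-- The spin-1/2 Heisenberg Hamiltonian `H = Σ_{{u,v} ∈ E(G)} ((1/2)·P_{uv} − (1/4)·Id)`. -/
noncomputable def Ham [Fintype V] [DecidableEq V] (G : SimpleGraph V) [DecidableRel G.Adj] :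
    Matrix (Conf V) (Conf V) ℂ :=
  ∑ e ∈ G.edgeFinset,
    Sym2.lift ⟨fun u v => (1/2 : ℂ) • swapOp u v - (1/4 : ℂ) • 1,
      fun u v => by dsimp only; rw [swapOp_comm]⟩ e

/-- The configuration `σ_n` whose single down spin is at `n`. -/
def singleDown [DecidableEq V] (n : V) : Conf V := fun w => decide (w = n)

/-- The one-magnon block `H₁` of `H`, as a matrix indexed by `V`
(via the identification `e_{σ_n} ↦ e_n`). -/
noncomputable def H1 [Fintype V] [DecidableEq V] (G : SimpleGraph V) [DecidableRel G.Adj] :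
    Matrix V V ℂ :=
  Matrix.of fun m n => Ham G (singleDown m) (singleDown n)

/-- Number of down spins `|A_σ|` of a configuration. -/
def downCard [Fintype V] (σ : Conf V) : ℕ := (Finset.univ.filter fun u => σ u = true).card

/-- `e(A_σ, V∖A_σ)`: the number of edges joining the down-set to its complement. -/
noncomputable def crossCount (G : SimpleGraph V) (σ : Conf V) : ℕ :=
  {e : Sym2 V | e ∈ G.edgeSet ∧ ∃ u v : V, σ u = true ∧ σ v = false ∧ e = s(u, v)}.ncard

/-- `e(A_σ)`: the number of edges with both endpoints in the down-set. -/
noncomputable def inCount (G : SimpleGraph V) (σ : Conf V) : ℕ :=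
  {e : Sym2 V | e ∈ G.edgeSet ∧ ∀ u ∈ e, σ u = true}.ncard

/-- The spin-1/2 XXZ Hamiltonian `H_Δ`, defined by its matrix elements:
`⟨e_σ, H_Δ e_σ⟩ = (Δ/4)·(L − 2·e(A_σ, V∖A_σ))` and `⟨e_τ, H_Δ e_σ⟩ = 1/2` iff `τ` arises from `σ`
by interchanging the unequal spin values at the endpoints of an edge. -/
noncomputable def HamXXZ [Fintype V] [DecidableEq V] (G : SimpleGraph V) [DecidableRel G.Adj]
    (Δ : ℝ) : Matrix (Conf V) (Conf V) ℂ :=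
  Matrix.of fun τ σ =>
    if τ = σ then ((Δ : ℂ)/4) * ((G.edgeFinset.card : ℂ) - 2 * crossCount G σ)
    else if ∃ u v : V, G.Adj u v ∧ σ u ≠ σ v ∧ τ = σ ∘ (Equiv.swap u v) then 1/2 else 0

/-- The one-magnon block `H₁^Δ` of the XXZ Hamiltonian. -/
noncomputable def H1XXZ [Fintype V] [DecidableEq V] (G : SimpleGraph V) [DecidableRel G.Adj]
    (Δ : ℝ) : Matrix V V ℂ :=
  Matrix.of fun m n => HamXXZ G Δ (singleDown m) (singleDown n)

section XXZ

variable [Fintype V] [DecidableEq V] (G : SimpleGraph V) [DecidableRel G.Adj]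

/-- The oriented edges `(u, v)` of `G` leading from a down spin of `σ` to an up spin of `σ`. -/
def hops (σ : Conf V) : Finset (V × V) :=
  Finset.univ.filter fun p => G.Adj p.1 p.2 ∧ σ p.1 = true ∧ σ p.2 = false

variable {G}

omit [DecidableEq V] in
lemma mem_hops {σ : Conf V} {p : V × V} :
    p ∈ hops G σ ↔ G.Adj p.1 p.2 ∧ σ p.1 = true ∧ σ p.2 = false := by
  simp [hops]

omit [DecidableEq V] in
lemma crossCount_eq_card_hops (σ : Conf V) : crossCount G σ = (hops G σ).card := by
  have h : {e : Sym2 V | e ∈ G.edgeSet ∧ ∃ u v : V, σ u = true ∧ σ v = false ∧ e = s(u, v)}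
      = (fun p : V × V => s(p.1, p.2)) '' (hops G σ : Set (V × V)) := by
    ext e
    simp only [Set.mem_ofPred_eq, Set.mem_image, Finset.mem_coe, mem_hops, Prod.exists]
    constructor
    · rintro ⟨he, u, v, hu, hv, rfl⟩
      exact ⟨u, v, ⟨he, hu, hv⟩, rfl⟩
    · rintro ⟨u, v, ⟨he, hu, hv⟩, rfl⟩
      exact ⟨he, u, v, hu, hv, rfl⟩
  rw [crossCount, h, Set.InjOn.ncard_image, Set.ncard_coe_finset]
  rintro ⟨u, v⟩ hp ⟨u', v'⟩ hq hpq
  simp only [Finset.mem_coe, mem_hops] at hp hq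
  simp only [Sym2.eq_iff] at hpq
  rcases hpq with ⟨rfl, rfl⟩ | ⟨rfl, rfl⟩
  · rfl
  · simp_all

lemma crossCount_le {j : ℕ} (hreg : G.IsRegularOfDegree j) (σ : Conf V) :
    crossCount G σ ≤ downCard σ * j := by
  rw [crossCount_eq_card_hops, downCard]
  refine le_trans (Finset.card_le_card ?_) (Finset.card_biUnion_le_card_mul _
    (fun u => (G.neighborFinset u).image (Prod.mk u)) j fun u _ => ?_)
  · rintro ⟨u, v⟩ hp
    simp_all [mem_hops]
  · exact Finset.card_image_le.trans (hreg u).le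

lemma crossCount_singleDown {j : ℕ} (hreg : G.IsRegularOfDegree j) (n : V) :
    crossCount G (singleDown n) = j := by
  have h : hops G (singleDown n) = (G.neighborFinset n).image (Prod.mk n) := by
    ext ⟨u, v⟩
    simp only [mem_hops, singleDown, decide_eq_true_eq, decide_eq_false_iff_not,
      Finset.mem_image, SimpleGraph.mem_neighborFinset, Prod.mk.injEq]
    constructor
    · rintro ⟨h, rfl, -⟩
      exact ⟨v, h, rfl, rfl⟩
    · rintro ⟨w, h, rfl, rfl⟩
      exact ⟨h, rfl, h.ne'⟩
  rw [crossCount_eq_card_hops, h, Finset.card_image_of_injective _ (Prod.mk_right_injective n)]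
  exact hreg n

lemma hop_injOn (σ : Conf V) :
    Set.InjOn (fun p : V × V => σ ∘ Equiv.swap p.1 p.2) (hops G σ : Set (V × V)) := by
  rintro ⟨u, v⟩ hp ⟨u', v'⟩ hq hpq
  simp only [Finset.mem_coe, mem_hops] at hp hq
  obtain ⟨-, hu, hv⟩ := hp
  obtain ⟨-, hu', hv'⟩ := hq
  have hpu := congrFun hpq u
  have hpv := congrFun hpq v
  simp only [Function.comp_apply, Equiv.swap_apply_left, Equiv.swap_apply_right] at hpu hpv
  have h1 : u = u' := by
    by_contra hne
    have hne' : u ≠ v' := by rintro rfl; simp_all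
    rw [Equiv.swap_apply_of_ne_of_ne hne hne'] at hpu
    simp_all
  have h2 : v = v' := by
    by_contra hne
    have hne' : v ≠ u' := by rintro rfl; simp_all
    rw [Equiv.swap_apply_of_ne_of_ne hne' hne] at hpv
    simp_all
  rw [h1, h2]

lemma hop_ne {σ : Conf V} {p : V × V} (hp : p ∈ hops G σ) :
    σ ∘ Equiv.swap p.1 p.2 ≠ σ := by
  intro h
  have := congrFun h p.1
  rw [mem_hops] at hp
  simp_all

omit [Fintype V] in
lemma comp_swap_comp_swap (σ : Conf V) (u v : V) :
    (σ ∘ Equiv.swap u v) ∘ Equiv.swap u v = σ := by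
  ext w
  simp

lemma exists_exchange_iff (σ ρ : Conf V) :
    (∃ u v : V, G.Adj u v ∧ ρ u ≠ ρ v ∧ σ = ρ ∘ Equiv.swap u v) ↔
      ∃ p ∈ hops G σ, σ ∘ Equiv.swap p.1 p.2 = ρ := by
  constructor
  · rintro ⟨u, v, huv, hne, rfl⟩
    rcases hu : ρ u with _ | _
    · refine ⟨(u, v), ?_, comp_swap_comp_swap ρ u v⟩
      simp_all [mem_hops]
    · refine ⟨(v, u), ?_, ?_⟩
      · simp_all [mem_hops, huv.symm]
      · simp only [Equiv.swap_comm v u, comp_swap_comp_swap]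
  · rintro ⟨⟨u, v⟩, hp, rfl⟩
    rw [mem_hops] at hp
    refine ⟨u, v, hp.1, ?_, (comp_swap_comp_swap σ u v).symm⟩
    simp_all

lemma HamXXZ_mulVec (Δ : ℝ) (ψ : Conf V → ℂ) (σ : Conf V) :
    (HamXXZ G Δ *ᵥ ψ) σ = ((Δ : ℂ) / 4) * ((G.edgeFinset.card : ℂ) - 2 * crossCount G σ) * ψ σ
      + 1 / 2 * ∑ p ∈ hops G σ, ψ (σ ∘ Equiv.swap p.1 p.2) := by
  classical
  have hentry : ∀ ρ, HamXXZ G Δ σ ρ * ψ ρ =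
      (if σ = ρ then ((Δ : ℂ) / 4) * ((G.edgeFinset.card : ℂ) - 2 * crossCount G σ) * ψ ρ else 0)
      + (if ρ ∈ (hops G σ).image (fun p => σ ∘ Equiv.swap p.1 p.2) then 1 / 2 * ψ ρ else 0) := by
    intro ρ
    simp only [HamXXZ, Matrix.of_apply, exists_exchange_iff, Finset.mem_image]
    by_cases h : σ = ρ
    · subst h
      have : ¬ ∃ p ∈ hops G σ, σ ∘ Equiv.swap p.1 p.2 = σ := by
        rintro ⟨p, hp, h⟩
        exact hop_ne hp h
      rw [if_pos rfl, if_pos rfl, if_neg this, add_zero]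
    · rw [if_neg h, if_neg h, zero_add, ite_mul, zero_mul]
  rw [Matrix.mulVec, dotProduct, Finset.sum_congr rfl fun ρ _ => hentry ρ,
    Finset.sum_add_distrib, Finset.sum_ite_eq, if_pos (Finset.mem_univ _),
    Finset.sum_ite_mem, Finset.univ_inter, Finset.sum_image (hop_injOn σ), Finset.mul_sum]

lemma exists_exchange_singleDown_iff {m n : V} (hmn : m ≠ n) :
    (∃ u v : V, G.Adj u v ∧ singleDown n u ≠ singleDown n v ∧
      singleDown m = singleDown n ∘ Equiv.swap u v) ↔ G.Adj m n := by
  rw [exists_exchange_iff]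
  constructor
  · rintro ⟨⟨u, v⟩, hp, h⟩
    simp only [mem_hops, singleDown, decide_eq_true_eq, decide_eq_false_iff_not] at hp
    obtain ⟨huv, rfl, -⟩ := hp
    have := congrFun h v
    simp only [singleDown, Function.comp_apply, Equiv.swap_apply_right] at this
    have hv : v = n := by simpa using this.symm
    exact hv ▸ huv
  · intro h
    refine ⟨(m, n), ?_, ?_⟩
    · simp [mem_hops, singleDown, h, h.ne']
    · ext w
      simp only [singleDown, Function.comp_apply]
      exact decide_eq_decide.2 (by rw [Equiv.swap_apply_eq_iff, Equiv.swap_apply_left])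

omit [Fintype V] in
lemma singleDown_injective : Function.Injective (singleDown : V → Conf V) := by
  intro m n h
  have := congrFun h m
  simpa [singleDown] using this

lemma H1XXZ_eq {j : ℕ} (hreg : G.IsRegularOfDegree j) (Δ : ℝ) :
    H1XXZ G Δ = ((Δ / 4 * (G.edgeFinset.card - 2 * j) : ℝ) : ℂ) • (1 : Matrix V V ℂ)
      + (1 / 2 : ℂ) • G.adjMatrix ℂ := by
  ext m n
  by_cases h : m = n
  · subst h
    simp [H1XXZ, HamXXZ, crossCount_singleDown hreg]
  · have h' : singleDown m ≠ singleDown n := fun e => h (singleDown_injective e)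
    simp only [H1XXZ, HamXXZ, Matrix.of_apply, if_neg h', exists_exchange_singleDown_iff h]
    simp [h, SimpleGraph.adjMatrix_apply]

/-- The Rayleigh bound for a Hermitian matrix all of whose eigenvalues are at least `E`. -/
lemma posSemidef_sub_smul_one {B : Matrix V V ℂ} (hB : B.IsHermitian) (E : ℝ)
    (hE : ∀ μ : ℝ, (∃ x : V → ℂ, x ≠ 0 ∧ B *ᵥ x = (μ : ℂ) • x) → E ≤ μ) :
    (B - (E : ℂ) • (1 : Matrix V V ℂ)).PosSemidef := by
  have hH : (B - (E : ℂ) • (1 : Matrix V V ℂ)).IsHermitian := by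
    refine hB.sub ?_
    simp [Matrix.IsHermitian, Matrix.conjTranspose_smul]
  rw [hH.posSemidef_iff_eigenvalues_nonneg]
  intro i
  have h := hH.mulVec_eigenvectorBasis i
  have := hE (hH.eigenvalues i + E) ⟨⇑(hH.eigenvectorBasis i), ?_, ?_⟩
  · simpa using this
  · intro h0
    apply (hH.eigenvectorBasis.orthonormal.ne_zero i)
    ext v
    exact congrFun h0 v
  · rw [Matrix.sub_mulVec, Matrix.smul_mulVec, Matrix.one_mulVec, sub_eq_iff_eq_add] at h
    rw [h]
    ext v
    simp [add_mul]

lemma adjMatrix_rayleigh {j : ℕ} (hreg : G.IsRegularOfDegree j) (Δ E : ℝ)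
    (hE : ∀ μ : ℝ, (∃ x : V → ℂ, x ≠ 0 ∧ H1XXZ G Δ *ᵥ x = (μ : ℂ) • x) → E ≤ μ) (x : V → ℂ) :
    (E - Δ / 4 * (G.edgeFinset.card - 2 * j)) * ∑ v, ‖x v‖ ^ 2 ≤
      1 / 2 * (∑ u, ∑ v, if G.Adj u v then star (x u) * x v else 0).re := by
  have hH : (H1XXZ G Δ).IsHermitian := by
    rw [H1XXZ_eq hreg]
    ext m n
    by_cases h : m = n
    · simp [h, SimpleGraph.adjMatrix_apply]
    · simp [h, Ne.symm h, SimpleGraph.adjMatrix_apply, G.adj_comm m n, apply_ite]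
  have h := (posSemidef_sub_smul_one hH E hE).dotProduct_mulVec_nonneg x
  have hn : star x ⬝ᵥ x = ((∑ v, ‖x v‖ ^ 2 : ℝ) : ℂ) := by
    simp [dotProduct, Complex.conj_mul']
  have hA : star x ⬝ᵥ (G.adjMatrix ℂ *ᵥ x) =
      ∑ u, ∑ v, if G.Adj u v then star (x u) * x v else 0 := by
    simp [dotProduct, Matrix.mulVec, SimpleGraph.adjMatrix_apply, Finset.mul_sum]
  rw [H1XXZ_eq hreg, Matrix.sub_mulVec, Matrix.add_mulVec, Matrix.smul_mulVec, Matrix.smul_mulVec,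
    Matrix.smul_mulVec, Matrix.one_mulVec, dotProduct_sub, dotProduct_add, dotProduct_smul,
    dotProduct_smul, dotProduct_smul, hn, hA] at h
  have h' := (Complex.le_def.1 h).1
  simp only [smul_eq_mul, Complex.sub_re, Complex.add_re, Complex.re_ofReal_mul, Complex.zero_re,
    Complex.ofReal_re] at h'
  rw [show (1 / 2 : ℂ) = ((1 / 2 : ℝ) : ℂ) by norm_num, Complex.re_ofReal_mul] at h'
  linarith

/-- The one-particle wave function obtained from `ψ` by freezing all down spins but one at `τ`. -/
def addDown (ψ : Conf V → ℂ) (τ : Conf V) (v : V) : ℂ :=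
  if τ v = true then 0 else ψ (Function.update τ v true)

lemma sum_addDown (ψ : Conf V → ℂ) (a : ℕ) (hψ : ∀ σ, ψ σ ≠ 0 → downCard σ = a) :
    ∑ τ, ∑ v, ‖addDown ψ τ v‖ ^ 2 = a * ∑ σ, ‖ψ σ‖ ^ 2 := by
  have h1 : ∀ v, ∑ τ, ‖addDown ψ τ v‖ ^ 2 = ∑ σ : Conf V, if σ v = true then ‖ψ σ‖ ^ 2 else 0 := by
    intro v
    rw [← Finset.sum_filter]
    have : ∀ τ, ‖addDown ψ τ v‖ ^ 2 =
        if τ v = false then ‖ψ (Function.update τ v true)‖ ^ 2 else 0 := by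
      intro τ
      cases h : τ v <;> simp [addDown, h]
    rw [Finset.sum_congr rfl fun τ _ => this τ, ← Finset.sum_filter]
    refine Finset.sum_bij' (fun τ _ => Function.update τ v true)
      (fun σ _ => Function.update σ v false) ?_ ?_ ?_ ?_ ?_ <;> simp +contextual
  rw [Finset.sum_comm, Finset.sum_congr rfl fun v _ => h1 v, Finset.sum_comm, Finset.mul_sum]
  refine Finset.sum_congr rfl fun σ _ => ?_
  rw [← Finset.sum_filter, Finset.sum_const, nsmul_eq_mul]
  by_cases h : ψ σ = 0
  · simp [h]
  · rw [← hψ σ h, downCard]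

lemma sum_addDown_adj (ψ : Conf V → ℂ) :
    ∑ τ, ∑ u, ∑ v, (if G.Adj u v then star (addDown ψ τ u) * addDown ψ τ v else 0) =
      ∑ σ, star (ψ σ) * ∑ p ∈ hops G σ, ψ (σ ∘ Equiv.swap p.1 p.2) := by
  have hL : ∀ τ, ∑ u, ∑ v, (if G.Adj u v then star (addDown ψ τ u) * addDown ψ τ v else 0) =
      ∑ p : V × V, if G.Adj p.1 p.2 then star (addDown ψ τ p.1) * addDown ψ τ p.2 else 0 :=
    fun τ => (Fintype.sum_prod_type fun p : V × V =>
      if G.Adj p.1 p.2 then star (addDown ψ τ p.1) * addDown ψ τ p.2 else 0).symm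
  have hR : ∀ σ, star (ψ σ) * ∑ p ∈ hops G σ, ψ (σ ∘ Equiv.swap p.1 p.2) =
      ∑ p : V × V, if G.Adj p.1 p.2 ∧ σ p.1 = true ∧ σ p.2 = false then
        star (ψ σ) * ψ (σ ∘ Equiv.swap p.1 p.2) else 0 := by
    intro σ
    rw [hops, Finset.mul_sum, Finset.sum_filter]
  simp only [hL, hR]
  rw [Finset.sum_comm, Finset.sum_comm (s := Finset.univ (α := Conf V))]
  refine Finset.sum_congr rfl fun ⟨u, v⟩ _ => ?_
  by_cases huv : G.Adj u v
  swap
  · simp [huv]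
  have hne := huv.ne
  have hL' : ∀ τ, star (addDown ψ τ u) * addDown ψ τ v = if τ u = false ∧ τ v = false then
      star (ψ (Function.update τ u true)) * ψ (Function.update τ v true) else 0 := by
    intro τ
    cases hu : τ u <;> cases hv : τ v <;> simp [addDown, hu, hv]
  simp only [huv, if_true, true_and, hL']
  rw [← Finset.sum_filter, ← Finset.sum_filter]
  refine Finset.sum_bij' (fun τ _ => Function.update τ u true)
    (fun σ _ => Function.update σ u false) ?_ ?_ ?_ ?_ ?_
  · simp +contextual [hne.symm]
  · simp +contextual [hne.symm]
  · intro τ h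
    simp only [Finset.mem_filter] at h
    rw [Function.update_idem, ← h.2.1, Function.update_eq_self]
  · intro σ h
    simp only [Finset.mem_filter] at h
    rw [Function.update_idem, ← h.2.1, Function.update_eq_self]
  · intro τ h
    simp only [Finset.mem_filter] at h
    congr 2
    ext w
    by_cases hwu : w = u
    · subst hwu
      simp [h.2.1, h.2.2, hne, hne.symm]
    by_cases hwv : w = v
    · subst hwv
      simp
    simp [Equiv.swap_apply_of_ne_of_ne hwu hwv, hwu, hwv]

end XXZ

/-- (Proposition 3 for the XXZ model) For `Δ ≥ 0`,
`E_a^Δ ≥ Δ·(1−a)·N·j/8 + a·E₁^Δ` for all `1 ≤ a ≤ N`. -/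
theorem prop3_XXZ [Fintype V] [DecidableEq V]
    (G : SimpleGraph V) [DecidableRel G.Adj] (N j : ℕ)
    (hN : Fintype.card V = N) (hreg : G.IsRegularOfDegree j)
    (Δ : ℝ) (hΔ : 0 ≤ Δ) (a : ℕ) (ha : 1 ≤ a) (haN : a ≤ N) (E1 Ea : ℝ)
    (hE1 : IsLeast {E : ℝ | ∃ x : V → ℂ, x ≠ 0 ∧ H1XXZ G Δ *ᵥ x = (E : ℂ) • x} E1)
    (hEa : IsLeast {E : ℝ | ∃ ψ : Conf V → ℂ, ψ ≠ 0 ∧ (∀ σ, ψ σ ≠ 0 → downCard σ = a)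
        ∧ HamXXZ G Δ *ᵥ ψ = (E : ℂ) • ψ} Ea) :
    Ea ≥ Δ * (1 - (a : ℝ)) * N * j / 8 + a * E1 := by
  obtain ⟨⟨ψ, hψ0, hψa, hψ⟩, -⟩ := hEa
  have hL : (N : ℝ) * j = 2 * G.edgeFinset.card := by
    have h := G.sum_degrees_eq_twice_card_edges
    simp only [hreg.degree_eq, Finset.sum_const, Finset.card_univ, hN, smul_eq_mul] at h
    exact_mod_cast h
  set L : ℝ := (G.edgeFinset.card : ℝ) with hLdef
  have hpos : 0 < ∑ σ, ‖ψ σ‖ ^ 2 := by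
    obtain ⟨σ, hσ⟩ := Function.ne_iff.1 hψ0
    exact Finset.sum_pos' (fun _ _ => by positivity)
      ⟨σ, Finset.mem_univ _, by have := norm_pos_iff.2 hσ; positivity⟩
  have henergy : ∀ σ, Ea * ‖ψ σ‖ ^ 2 = Δ / 4 * (L - 2 * crossCount G σ) * ‖ψ σ‖ ^ 2
      + 1 / 2 * (star (ψ σ) * ∑ p ∈ hops G σ, ψ (σ ∘ Equiv.swap p.1 p.2)).re := by
    intro σ
    have h := congrFun hψ σ
    rw [HamXXZ_mulVec, Pi.smul_apply, smul_eq_mul] at h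
    have hn : star (ψ σ) * ψ σ = ((‖ψ σ‖ ^ 2 : ℝ) : ℂ) := by
      simp [Complex.conj_mul']
    have h2 : ((Ea * ‖ψ σ‖ ^ 2 : ℝ) : ℂ) =
        ((Δ / 4 * (L - 2 * crossCount G σ) * ‖ψ σ‖ ^ 2 : ℝ) : ℂ)
        + ((1 / 2 : ℝ) : ℂ) * (star (ψ σ) * ∑ p ∈ hops G σ, ψ (σ ∘ Equiv.swap p.1 p.2)) := by
      rw [Complex.ofReal_mul, Complex.ofReal_mul _ (‖ψ σ‖ ^ 2), ← hn]
      push_cast [hLdef]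
      linear_combination -star (ψ σ) * h
    have h3 := congrArg Complex.re h2
    rwa [Complex.add_re, Complex.re_ofReal_mul, Complex.ofReal_re, Complex.ofReal_re] at h3
  have hdiag : ∀ σ, Δ / 4 * (L - 2 * (a * j)) * ‖ψ σ‖ ^ 2 ≤
      Δ / 4 * (L - 2 * crossCount G σ) * ‖ψ σ‖ ^ 2 := by
    intro σ
    by_cases h : ψ σ = 0
    · simp [h]
    · have hc : (crossCount G σ : ℝ) ≤ a * j := by
        rw [← hψa σ h]
        exact_mod_cast crossCount_le hreg σ
      gcongr
  have hhop : (E1 - Δ / 4 * (L - 2 * j)) * (a * ∑ σ, ‖ψ σ‖ ^ 2) ≤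
      1 / 2 * ∑ σ, (star (ψ σ) * ∑ p ∈ hops G σ, ψ (σ ∘ Equiv.swap p.1 p.2)).re := by
    rw [← sum_addDown ψ a hψa, ← Complex.re_sum, ← sum_addDown_adj, Complex.re_sum,
      Finset.mul_sum, Finset.mul_sum]
    exact Finset.sum_le_sum fun τ _ =>
      adjMatrix_rayleigh hreg Δ E1 (fun μ hμ => hE1.2 hμ) (addDown ψ τ)
  have htotal : Ea * ∑ σ, ‖ψ σ‖ ^ 2 ≥ Δ / 4 * (L - 2 * (a * j)) * ∑ σ, ‖ψ σ‖ ^ 2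
      + (E1 - Δ / 4 * (L - 2 * j)) * (a * ∑ σ, ‖ψ σ‖ ^ 2) := by
    rw [Finset.mul_sum, Finset.sum_congr rfl fun σ _ => henergy σ, Finset.sum_add_distrib,
      ← Finset.mul_sum _ _ (1 / 2 : ℝ), Finset.mul_sum _ _ (Δ / 4 * (L - 2 * (a * j)))]
    exact add_le_add (Finset.sum_le_sum fun σ _ => hdiag σ) hhop
  refine le_of_mul_le_mul_right (le_trans (le_of_eq ?_) htotal) hpos
  linear_combination (Δ * (1 - a) / 8 * ∑ σ, ‖ψ σ‖ ^ 2) * hL
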